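/- Let (X,d) be a metric space with marked point p. If every pretangent space Ω_{p,r̃}^X is a geodesic metric space which is Busemann convex, then X is Busemann convex at p. -/

import Mathlib

open Filter Topology

universe u

section Defs

variable {X : Type u} [MetricSpace X]

/-- A normalizing sequence is a sequence of positive reals tending to zero. -/
def IsNormalizingSeq (r : ℕ → ℝ) : Prop :=
  (∀ n, 0 < r n) ∧ Tendsto r atTop (𝓝 0)

/-- Two sequences of points of `X` are mutually stable w.r.t. `r` if
`d(x_n, y_n)/r_n` converges to a finite limit. -/
def MutuallyStable (r : ℕ → ℝ) (x y : ℕ → X) : Prop :=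
  ∃ L : ℝ, Tendsto (fun n => dist (x n) (y n) / r n) atTop (𝓝 L)

/-- A family of sequences is self-stable if any two members are mutually stable. -/
def SelfStable (r : ℕ → ℝ) (F : Set (ℕ → X)) : Prop :=
  ∀ x ∈ F, ∀ y ∈ F, MutuallyStable r x y

/-- A maximal self-stable family containing the constant sequence `p`. -/
def MaximalSelfStable (p : X) (r : ℕ → ℝ) (F : Set (ℕ → X)) : Prop :=
  SelfStable r F ∧ (fun _ => p) ∈ F ∧
    ∀ G : Set (ℕ → X), SelfStable r G → F ⊆ G → G = F

/-- `(Ω, π)` is (a realization of) the pretangent space of `X` at `p`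
with respect to the normalizing sequence `r` and the maximal self-stable family
`F`; the map `π` is the metric identification projection, so that the distance
in `Ω` between `π x` and `π y` is `lim_n d(x_n,y_n)/r_n`. -/
def IsPretangentSpace (p : X) (r : ℕ → ℝ) (F : Set (ℕ → X))
    {Ω : Type u} [MetricSpace Ω] (π : (ℕ → X) → Ω) : Prop :=
  IsNormalizingSeq r ∧ MaximalSelfStable p r F ∧
    (∀ ω : Ω, ∃ x ∈ F, π x = ω) ∧
    ∀ x ∈ F, ∀ y ∈ F,
      Tendsto (fun n => dist (x n) (y n) / r n) atTop (𝓝 (dist (π x) (π y)))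

/-- The pretangent space determined by the maximal self-stable family `F` is
tangent: for every strictly increasing sequence `φ` of naturals and every
maximal self-stable family `F'` w.r.t. `r ∘ φ` containing all `x ∘ φ` with
`x ∈ F`, the canonical isometric embedding `em'` is bijective (being always an
isometric embedding it suffices that it be surjective, as stated here). -/
def IsTangentFamily (p : X) (r : ℕ → ℝ) (F : Set (ℕ → X)) : Prop :=
  ∀ φ : ℕ → ℕ, StrictMono φ →
    ∀ F' : Set (ℕ → X), MaximalSelfStable p (r ∘ φ) F' →
      (∀ x ∈ F, x ∘ φ ∈ F') →
      ∀ y ∈ F', ∃ x ∈ F,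
        Tendsto (fun k => dist (x (φ k)) (y k) / r (φ k)) atTop (𝓝 0)

/-- `δ_p(w,x,y,z) = max_i d(x_i, p)`. -/
noncomputable def delta4 (p w x y z : X) : ℝ :=
  max (dist w p) (max (dist x p) (max (dist y p) (dist z p)))

/-- `δ_p(x,y,z) = max_i d(x_i, p)`. -/
noncomputable def delta3 (p x y z : X) : ℝ :=
  max (dist x p) (max (dist y p) (dist z p))

open Classical in
/-- The function `A₁` of Berg–Nikolaev type. -/
noncomputable def A1 (p w x y z : X) : ℝ :=
  if w = p ∧ x = p ∧ y = p ∧ z = p then 0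
  else (dist w x ^ 2 + dist x y ^ 2 + dist y z ^ 2 + dist z w ^ 2
          - dist w y ^ 2 - dist x z ^ 2) / delta4 p w x y z ^ 2

open Classical in
/-- The function `A₂` of Lebedeva–Petrunin type. -/
noncomputable def A2 (p w x y z : X) : ℝ :=
  if w = p ∧ x = p ∧ y = p ∧ z = p then 0
  else (dist w x ^ 2 + dist w y ^ 2 + dist w z ^ 2
          - (dist x y ^ 2 + dist y z ^ 2 + dist z x ^ 2) / 3) / delta4 p w x y z ^ 2

open Classical in
/-- The function `A₃` of Ptolemy type. -/
noncomputable def A3 (p w x y z : X) : ℝ :=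
  if w = p ∧ x = p ∧ y = p ∧ z = p then 0
  else (dist x w * dist y z + dist x z * dist y w - dist x y * dist w z)
          / delta4 p w x y z ^ 2

open Classical in
/-- The quotient `|d(w,z) - d(x,y)/2| / δ_p(x,y)`, valued in `EReal`, with the
conventions: `0` if `x = y = p` and `z = p`, and `+∞` if `x = y = p` but `z ≠ p`. -/
noncomputable def midQuot (p w x y z : X) : EReal :=
  if x = p ∧ y = p then (if z = p then (0 : EReal) else ⊤)
  else ((|dist w z - dist x y / 2| / max (dist x p) (dist y p) : ℝ) : EReal)

/-- `z` is an infinitesimal midpoint of the sequences `x` and `y`. -/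
def IsInfinitesimalMidpoint (p : X) (x y z : ℕ → X) : Prop :=
  Tendsto (fun n => midQuot p (x n) (x n) (y n) (z n)) atTop (𝓝 (0 : EReal)) ∧
    Tendsto (fun n => midQuot p (y n) (x n) (y n) (z n)) atTop (𝓝 (0 : EReal))

/-- `X` is midpoint convex at the marked point `p`. -/
def MidpointConvexAt (p : X) : Prop :=
  ∀ x y : ℕ → X, Tendsto x atTop (𝓝 p) → Tendsto y atTop (𝓝 p) →
    ∃ z : ℕ → X, IsInfinitesimalMidpoint p x y z

/-- `X` is Busemann convex at the marked point `p`. -/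
def BusemannConvexAt (p : X) : Prop :=
  MidpointConvexAt p ∧
    ∀ x0 x1 y m : ℕ → X, Tendsto x0 atTop (𝓝 p) → Tendsto x1 atTop (𝓝 p) →
      Tendsto y atTop (𝓝 p) → IsInfinitesimalMidpoint p x0 x1 m →
      Tendsto (fun n =>
          max (dist (m n) (y n) - (dist (x0 n) (y n) + dist (x1 n) (y n)) / 2) 0
            / delta3 p (x0 n) (y n) (x1 n)) atTop (𝓝 (0 : ℝ))

end Defs

section MetricDefs

/-- `s` is a geodesic segment with endpoints `x` and `y`: a subset isometric to
the closed interval `[0, d(x,y)]`, the endpoints of the interval corresponding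
to `x` and `y`. -/
def IsGeodesicSegment {Z : Type u} [MetricSpace Z] (s : Set Z) (x y : Z) : Prop :=
  ∃ f : ℝ → Z,
    (∀ a ∈ Set.Icc 0 (dist x y), ∀ b ∈ Set.Icc 0 (dist x y),
      dist (f a) (f b) = |a - b|) ∧
    f '' Set.Icc 0 (dist x y) = s ∧ f 0 = x ∧ f (dist x y) = y

/-- A metric space is geodesic if any two points are the endpoints of some
geodesic segment. -/
def IsGeodesicSpace (Y : Type u) [MetricSpace Y] : Prop :=
  ∀ x y : Y, ∃ s : Set Y, IsGeodesicSegment s x y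

/-- `m` is a midpoint of `x` and `y`. -/
def IsMidpointOf {Z : Type u} [MetricSpace Z] (m x y : Z) : Prop :=
  dist m x = dist x y / 2 ∧ dist m y = dist x y / 2

/-- An affinely parametrized geodesic `γ : [a,b] → Z`:
`d(γ s, γ t) = λ |s - t|` for some constant `λ ≥ 0`. -/
def IsAffineGeodesic {Z : Type u} [MetricSpace Z] (γ : ℝ → Z) (a b : ℝ) : Prop :=
  ∃ lam : ℝ, 0 ≤ lam ∧ ∀ s ∈ Set.Icc a b, ∀ t ∈ Set.Icc a b,
    dist (γ s) (γ t) = lam * |s - t|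

/-- Busemann convexity of a (geodesic) metric space: for any two affinely
parametrized geodesics the joint distance function is convex. -/
def BusemannConvex (Y : Type u) [MetricSpace Y] : Prop :=
  ∀ (a b a' b' : ℝ) (γ γ' : ℝ → Y), IsAffineGeodesic γ a b →
    IsAffineGeodesic γ' a' b' →
    ConvexOn ℝ (Set.Icc a b ×ˢ Set.Icc a' b')
      (fun q : ℝ × ℝ => dist (γ q.1) (γ' q.2))

/-- A metric space is Ptolemaic if the Ptolemy inequality holds. -/
def Ptolemaic (Y : Type u) [MetricSpace Y] : Prop :=
  ∀ x y u v : Y, dist x y * dist u v ≤ dist x u * dist y v + dist x v * dist y u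

end MetricDefs

section Helpers

variable {X : Type u} [MetricSpace X]

lemma exists_maximal_aux (p : X) (r : ℕ → ℝ) (S : Set (ℕ → X)) (hS : SelfStable r S)
    (hp : (fun _ => p) ∈ S) : ∃ F, S ⊆ F ∧ MaximalSelfStable p r F := by
  obtain ⟨F, hSF, hF⟩ := zorn_subset_nonempty {G : Set (ℕ → X) | SelfStable r G} (by
    intro c hc hchain hne
    refine ⟨⋃₀ c, ?_, fun s hs => Set.subset_sUnion_of_mem hs⟩
    rintro x ⟨s, hs, hx⟩ y ⟨t, ht, hy⟩
    rcases hchain.total hs ht with hst | hst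
    · exact hc ht x (hst hx) y hy
    · exact hc hs x hx y (hst hy)) S hS
  refine ⟨F, hSF, hF.prop, hSF hp, fun G hG hFG => ?_⟩
  exact (hF.eq_of_subset hG hFG).symm

lemma exists_metric_quotient_aux {G : Type u} (L : G → G → ℝ) (h0 : ∀ x, L x x = 0)
    (hc : ∀ x y, L x y = L y x) (ht : ∀ x y z, L x z ≤ L x y + L y z) :
    ∃ (Ω : Type u) (_ : MetricSpace Ω) (q : G → Ω), Function.Surjective q ∧
      ∀ x y, dist (q x) (q y) = L x y := by
  let inst : PseudoMetricSpace G :=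
    { dist := L
      dist_self := h0
      dist_comm := hc
      dist_triangle := ht }
  exact ⟨SeparationQuotient G, inferInstance, SeparationQuotient.mk,
    SeparationQuotient.surjective_mk, fun x y => SeparationQuotient.dist_mk x y⟩

lemma exists_pretangent_aux (p : X) (r : ℕ → ℝ) (hr : IsNormalizingSeq r)
    (F : Set (ℕ → X)) (hF : MaximalSelfStable p r F) :
    ∃ (Ω : Type u) (_ : MetricSpace Ω) (π : (ℕ → X) → Ω), IsPretangentSpace p r F π := by
  classical
  have hst := hF.1
  choose L hL using fun (x y : F) => hst x x.2 y y.2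
  obtain ⟨Ω, inst, q, hq, hqd⟩ := exists_metric_quotient_aux L
    (fun x => by
      refine tendsto_nhds_unique (hL x x) ?_
      simp)
    (fun x y => by
      refine tendsto_nhds_unique (hL x y) ?_
      simpa [dist_comm] using hL y x)
    (fun x y z => by
      refine le_of_tendsto_of_tendsto' (hL x z) ((hL x y).add (hL y z)) fun n => ?_
      rw [← add_div]
      exact div_le_div_of_nonneg_right (dist_triangle _ _ _) (hr.1 n).le)
  refine ⟨Ω, inst, fun x => if hx : x ∈ F then q ⟨x, hx⟩ else q ⟨_, hF.2.1⟩, hr, hF, ?_, ?_⟩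
  · intro ω
    obtain ⟨x, rfl⟩ := hq ω
    exact ⟨x, x.2, by simp⟩
  · intro x hx y hy
    simp only [hx, hy, dif_pos, hqd]
    exact hL ⟨x, hx⟩ ⟨y, hy⟩

lemma exists_subseq_pretangent_aux {ι : Type} [Fintype ι] (p : X) (v : ι → ℕ → X) (i0 : ι)
    (h0 : v i0 = fun _ => p) (r : ℕ → ℝ) (hr : IsNormalizingSeq r) (K : ℝ)
    (hb : ∀ i n, dist (v i n) p ≤ K * r n) :
    ∃ φ : ℕ → ℕ, StrictMono φ ∧ ∃ (F : Set (ℕ → X)) (Ω : Type u) (_ : MetricSpace Ω)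
      (π : (ℕ → X) → Ω), IsPretangentSpace p (r ∘ φ) F π ∧ ∀ i, v i ∘ φ ∈ F := by
  let g : ℕ → (ι × ι → ℝ) := fun n ij => dist (v ij.1 n) (v ij.2 n) / r n
  have hg : ∀ n, g n ∈ Set.pi Set.univ (fun _ : ι × ι => Set.Icc (0 : ℝ) (2 * K)) := by
    intro n ij _
    have := hr.1 n
    refine ⟨by positivity, ?_⟩
    rw [div_le_iff₀ this]
    have h1 := hb ij.1 n
    have h2 := hb ij.2 n
    have := dist_triangle_right (v ij.1 n) (v ij.2 n) p
    linarith
  obtain ⟨a, -, φ, hφ, hlim⟩ :=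
    (isCompact_univ_pi (fun _ : ι × ι => isCompact_Icc (a := (0 : ℝ)) (b := 2 * K))).tendsto_subseq
      hg
  rw [tendsto_pi_nhds] at hlim
  have hr' : IsNormalizingSeq (r ∘ φ) :=
    ⟨fun n => hr.1 _, hr.2.comp hφ.tendsto_atTop⟩
  obtain ⟨F, hSF, hF⟩ := exists_maximal_aux p (r ∘ φ) (Set.range fun i => v i ∘ φ) (by
    rintro _ ⟨i, rfl⟩ _ ⟨j, rfl⟩
    exact ⟨a (i, j), hlim (i, j)⟩) ⟨i0, by simp only [h0]; rfl⟩
  obtain ⟨Ω, inst, π, hπ⟩ := exists_pretangent_aux p _ hr' F hF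
  exact ⟨φ, hφ, F, Ω, inst, π, hπ, fun i => hSF ⟨i, rfl⟩⟩

lemma geodesic_midpoint_aux {Z : Type u} [MetricSpace Z] (hg : IsGeodesicSpace Z) (x y : Z) :
    ∃ m, IsMidpointOf m x y := by
  obtain ⟨s, f, hf, -, h0, h1⟩ := hg x y
  have hd := dist_nonneg (x := x) (y := y)
  refine ⟨f (dist x y / 2), ?_, ?_⟩
  · have := hf (dist x y / 2) ⟨by linarith, by linarith⟩ 0 ⟨by linarith, by linarith⟩
    rw [h0, abs_of_nonneg (by linarith)] at this
    linarith
  · have := hf (dist x y / 2) ⟨by linarith, by linarith⟩ (dist x y) ⟨by linarith, by linarith⟩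
    rw [h1, abs_of_nonpos (by linarith)] at this
    linarith

lemma busemann_midpoint_aux {Z : Type u} [MetricSpace Z] (hg : IsGeodesicSpace Z)
    (hB : BusemannConvex Z) (x y m c : Z) (hm : IsMidpointOf m x y) :
    dist m c ≤ (dist x c + dist y c) / 2 := by
  obtain ⟨hmx, hmy⟩ := hm
  obtain ⟨-, f, hf, -, f0, f1⟩ := hg x m
  obtain ⟨-, g, hgg, -, g0, g1⟩ := hg m y
  have hD0 := dist_nonneg (x := x) (y := y)
  rw [dist_comm, hmx] at hf f1
  rw [hmy] at hgg g1
  set D := dist x y with hD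
  let γ : ℝ → Z := fun t => if t ≤ D / 2 then f t else g (t - D / 2)
  have key : ∀ s t, 0 ≤ s → s ≤ t → t ≤ D → dist (γ s) (γ t) = t - s := by
    intro s t hs hst ht
    simp only [γ]
    by_cases h1 : t ≤ D / 2
    · rw [if_pos h1, if_pos (hst.trans h1), hf s ⟨hs, by linarith⟩ t ⟨by linarith, h1⟩,
        abs_of_nonpos (by linarith)]
      ring
    · push Not at h1
      rw [if_neg (not_le.2 h1)]
      by_cases h2 : s ≤ D / 2
      · rw [if_pos h2]
        have e1 := hf 0 ⟨le_rfl, by linarith⟩ s ⟨hs, h2⟩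
        have e2 := hf s ⟨hs, h2⟩ (D / 2) ⟨by linarith, le_rfl⟩
        have e3 := hgg 0 ⟨le_rfl, by linarith⟩ (t - D / 2) ⟨by linarith, by linarith⟩
        have e4 := hgg (t - D / 2) ⟨by linarith, by linarith⟩ (D / 2) ⟨by linarith, le_rfl⟩
        rw [abs_of_nonpos (by linarith)] at e1 e2 e3 e4
        rw [f0] at e1
        rw [f1] at e2
        rw [g0] at e3
        rw [g1] at e4
        have t1 := dist_triangle (f s) m (g (t - D / 2))
        have t2 := dist_triangle4 x (f s) (g (t - D / 2)) y
        apply le_antisymm <;> linarith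
      · push Not at h2
        rw [if_neg (not_le.2 h2), hgg _ ⟨by linarith, by linarith⟩ _ ⟨by linarith, by linarith⟩,
          abs_of_nonpos (by linarith)]
        ring
  have hγ : IsAffineGeodesic γ 0 D := by
    refine ⟨1, zero_le_one, fun s hs t ht => ?_⟩
    rw [one_mul]
    rcases le_total s t with hst | hst
    · rw [key s t hs.1 hst ht.2, abs_of_nonpos (by linarith)]; ring
    · rw [dist_comm, key t s ht.1 hst hs.2, abs_of_nonneg (by linarith)]
  have hc : IsAffineGeodesic (fun _ : ℝ => c) 0 0 := ⟨0, le_rfl, by simp⟩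
  have hmem0 : ((0 : ℝ), (0 : ℝ)) ∈ Set.Icc (0 : ℝ) D ×ˢ Set.Icc (0 : ℝ) 0 :=
    ⟨⟨le_rfl, hD0⟩, ⟨le_rfl, le_rfl⟩⟩
  have hmem1 : (D, (0 : ℝ)) ∈ Set.Icc (0 : ℝ) D ×ˢ Set.Icc (0 : ℝ) 0 :=
    ⟨⟨hD0, le_rfl⟩, ⟨le_rfl, le_rfl⟩⟩
  have hcv := (hB 0 D 0 0 γ _ hγ hc).2
  have hconv := hcv hmem0 hmem1 (show (0 : ℝ) ≤ 1 / 2 by norm_num)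
    (show (0 : ℝ) ≤ 1 / 2 by norm_num) (by norm_num)
  have q0 : γ 0 = x := by simp only [γ]; rw [if_pos (by linarith), f0]
  have qm : γ (D / 2) = m := by simp only [γ]; rw [if_pos le_rfl, f1]
  have q1 : γ D = y := by
    have := key 0 D le_rfl hD0 le_rfl
    simp only [γ]
    split_ifs with h1
    · have hz : D = 0 := by linarith
      rw [hz, f0]
      exact dist_eq_zero.1 hz
    · rw [← g1]; congr 1; ring
  have e : (1 / 2 : ℝ) • ((0 : ℝ), (0 : ℝ)) + (1 / 2 : ℝ) • (D, (0 : ℝ)) = (D / 2, 0) := by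
    ext <;> simp <;> ring
  rw [e] at hconv
  simp only [q0, qm, q1, smul_eq_mul] at hconv
  linarith

lemma normalizing_one_div_aux : Tendsto (fun n : ℕ => (1 : ℝ) / ((n : ℝ) + 1)) atTop (𝓝 0) :=
  tendsto_one_div_add_atTop_nhds_zero_nat

lemma local_midpoint_aux (p : X)
    (h : ∀ (r : ℕ → ℝ) (F : Set (ℕ → X)) (Ω : Type u) [MetricSpace Ω]
      (π : (ℕ → X) → Ω), IsPretangentSpace p r F π →
      IsGeodesicSpace Ω ∧ BusemannConvex Ω) (ε : ℝ) (hε : 0 < ε) :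
    ∃ η > 0, ∀ a b : X, dist a p < η → dist b p < η → ∃ z,
      |dist a z - dist a b / 2| ≤ ε * max (dist a p) (dist b p) ∧
      |dist b z - dist a b / 2| ≤ ε * max (dist a p) (dist b p) := by
  by_contra! hcon
  choose a b ha hb hab using fun n : ℕ => hcon (1 / ((n : ℝ) + 1)) (by positivity)
  let r : ℕ → ℝ := fun n => max (dist (a n) p) (dist (b n) p)
  have hr : IsNormalizingSeq r := by
    constructor
    · intro n
      by_contra hn
      push Not at hn
      have h1 : a n = p := dist_le_zero.1 ((le_max_left _ _).trans hn)
      have h2 : b n = p := dist_le_zero.1 ((le_max_right _ _).trans hn)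
      have := hab n p (by simp [h1, h2])
      simp [h1, h2] at this
    · refine squeeze_zero (fun n => le_max_of_le_left dist_nonneg) (fun n => ?_)
        normalizing_one_div_aux
      exact max_le (ha n).le (hb n).le
  obtain ⟨φ, hφ, F, Ω, inst, π, hπ, hmem⟩ := exists_subseq_pretangent_aux p
    ![fun _ => p, a, b] 0 rfl r hr 1 (by
      intro i n
      rw [one_mul]
      have := (hr.1 n).le
      fin_cases i
      · simpa using this
      · exact le_max_left _ _
      · exact le_max_right _ _)
  have haF : a ∘ φ ∈ F := hmem 1
  have hbF : b ∘ φ ∈ F := hmem 2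
  obtain ⟨M, hMa, hMb⟩ := geodesic_midpoint_aux (h _ F Ω π hπ).1 (π (a ∘ φ)) (π (b ∘ φ))
  obtain ⟨z, hzF, rfl⟩ := hπ.2.2.1 M
  have lab := hπ.2.2.2 _ haF _ hbF
  have laz := hπ.2.2.2 _ haF _ hzF
  have lbz := hπ.2.2.2 _ hbF _ hzF
  rw [dist_comm, hMa] at laz
  rw [dist_comm, hMb] at lbz
  have l1 := (laz.sub (lab.div_const 2)).abs
  have l2 := (lbz.sub (lab.div_const 2)).abs
  rw [sub_self, abs_zero] at l1 l2
  obtain ⟨n, h1, h2⟩ := ((l1.eventually_lt_const hε).and (l2.eventually_lt_const hε)).exists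
  have hrn := hr.1 (φ n)
  have conv : ∀ u v : ℝ, |u / (r ∘ φ) n - v / (r ∘ φ) n / 2| < ε → |u - v / 2| < ε * r (φ n) := by
    intro u v huv
    have e : u / (r ∘ φ) n - v / (r ∘ φ) n / 2 = (u - v / 2) / r (φ n) := by
      simp only [Function.comp]; ring
    rw [e, abs_div, abs_of_pos hrn, div_lt_iff₀ hrn] at huv
    exact huv
  exact absurd (hab (φ n) (z n) (conv _ _ h1).le) (not_lt.2 (conv _ _ h2).le)

lemma local_busemann_aux (p : X)
    (h : ∀ (r : ℕ → ℝ) (F : Set (ℕ → X)) (Ω : Type u) [MetricSpace Ω]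
      (π : (ℕ → X) → Ω), IsPretangentSpace p r F π →
      IsGeodesicSpace Ω ∧ BusemannConvex Ω) (ε : ℝ) (hε : 0 < ε) :
    ∃ η > 0, ∀ a b c m : X, dist a p < η → dist b p < η → dist c p < η →
      |dist a m - dist a b / 2| ≤ η * max (dist a p) (dist b p) →
      |dist b m - dist a b / 2| ≤ η * max (dist a p) (dist b p) →
      dist m c - (dist a c + dist b c) / 2 ≤ ε * delta3 p a c b := by
  by_contra! hcon
  choose a b c m ha hb hc ham hbm hlt using
    fun n : ℕ => hcon (1 / ((n : ℝ) + 1)) (by positivity)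
  let r : ℕ → ℝ := fun n => delta3 p (a n) (c n) (b n)
  have hra : ∀ n, dist (a n) p ≤ r n := fun n => le_max_left _ _
  have hrc : ∀ n, dist (c n) p ≤ r n := fun n => (le_max_left _ _).trans (le_max_right _ _)
  have hrb : ∀ n, dist (b n) p ≤ r n := fun n => (le_max_right _ _).trans (le_max_right _ _)
  have hr : IsNormalizingSeq r := by
    constructor
    · intro n
      by_contra hn
      push Not at hn
      have h1 : a n = p := dist_le_zero.1 ((hra n).trans hn)
      have h2 : b n = p := dist_le_zero.1 ((hrb n).trans hn)
      have h3 : c n = p := dist_le_zero.1 ((hrc n).trans hn)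
      have h4 := ham n
      have h5 := hlt n
      simp [h1, h2] at h4
      simp [h1, h2, h3, delta3, ← h4] at h5
    · refine squeeze_zero (fun n => le_max_of_le_left dist_nonneg) (fun n => ?_)
        normalizing_one_div_aux
      exact max_le (ha n).le (max_le (hc n).le (hb n).le)
  have hone : ∀ n : ℕ, (1 : ℝ) / ((n : ℝ) + 1) ≤ 1 := fun n => by
    rw [div_le_one (by positivity)]; linarith [(Nat.cast_nonneg n : (0 : ℝ) ≤ n)]
  have hmax : ∀ n, max (dist (a n) p) (dist (b n) p) ≤ r n := fun n => max_le (hra n) (hrb n)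
  have ham' : ∀ n, |dist (a n) (m n) - dist (a n) (b n) / 2| ≤ 1 / ((n : ℝ) + 1) * r n :=
    fun n => (ham n).trans (mul_le_mul_of_nonneg_left (hmax n) (by positivity))
  have hbm' : ∀ n, |dist (b n) (m n) - dist (a n) (b n) / 2| ≤ 1 / ((n : ℝ) + 1) * r n :=
    fun n => (hbm n).trans (mul_le_mul_of_nonneg_left (hmax n) (by positivity))
  obtain ⟨φ, hφ, F, Ω, inst, π, hπ, hmem⟩ := exists_subseq_pretangent_aux p
    ![fun _ => p, a, b, c, m] 0 rfl r hr 3 (by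
      intro i n
      have := (hr.1 n).le
      fin_cases i
      · simpa using this
      · exact (hra n).trans (by linarith)
      · exact (hrb n).trans (by linarith)
      · exact (hrc n).trans (by linarith)
      · show dist (m n) p ≤ 3 * r n
        have h1 := (abs_le.1 (ham' n)).2
        have h2 := mul_le_mul_of_nonneg_right (hone n) this
        have h3 := dist_triangle_right (a n) (b n) p
        have h4 := dist_triangle_left (m n) p (a n)
        linarith [hra n, hrb n])
  have haF : a ∘ φ ∈ F := hmem 1
  have hbF : b ∘ φ ∈ F := hmem 2
  have hcF : c ∘ φ ∈ F := hmem 3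
  have hmF : m ∘ φ ∈ F := hmem 4
  obtain ⟨hG, hB⟩ := h _ F Ω π hπ
  have lab := hπ.2.2.2 _ haF _ hbF
  have lac := hπ.2.2.2 _ haF _ hcF
  have lbc := hπ.2.2.2 _ hbF _ hcF
  have lmc := hπ.2.2.2 _ hmF _ hcF
  have lam := hπ.2.2.2 _ haF _ hmF
  have lbm := hπ.2.2.2 _ hbF _ hmF
  have conv : ∀ (u v : ℕ → ℝ) (U V : ℝ),
      Tendsto (fun n => u (φ n) / (r ∘ φ) n) atTop (𝓝 U) →
      Tendsto (fun n => v (φ n) / (r ∘ φ) n) atTop (𝓝 V) →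
      (∀ n, |u n - v n / 2| ≤ 1 / ((n : ℝ) + 1) * r n) → U = V / 2 := by
    intro u v U V hU hV huv
    have l1 := hU.sub (hV.div_const 2)
    have l2 : Tendsto (fun n => u (φ n) / (r ∘ φ) n - v (φ n) / (r ∘ φ) n / 2) atTop (𝓝 0) := by
      refine squeeze_zero_norm (fun n => ?_) (normalizing_one_div_aux.comp hφ.tendsto_atTop)
      have hrn := hr.1 (φ n)
      have e : u (φ n) / (r ∘ φ) n - v (φ n) / (r ∘ φ) n / 2
          = (u (φ n) - v (φ n) / 2) / r (φ n) := by
        simp only [Function.comp]; ring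
      rw [e, Real.norm_eq_abs, abs_div, abs_of_pos hrn, div_le_iff₀ hrn]
      exact huv (φ n)
    linarith [tendsto_nhds_unique l1 l2]
  have hmid : IsMidpointOf (π (m ∘ φ)) (π (a ∘ φ)) (π (b ∘ φ)) := by
    constructor
    · rw [dist_comm]
      exact conv (fun n => dist (a n) (m n)) (fun n => dist (a n) (b n)) _ _ lam lab ham'
    · rw [dist_comm]
      exact conv (fun n => dist (b n) (m n)) (fun n => dist (a n) (b n)) _ _ lbm lab hbm'
  have hfin := busemann_midpoint_aux hG hB _ _ _ (π (c ∘ φ)) hmid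
  have hge : ε ≤ dist (π (m ∘ φ)) (π (c ∘ φ)) -
      (dist (π (a ∘ φ)) (π (c ∘ φ)) + dist (π (b ∘ φ)) (π (c ∘ φ))) / 2 := by
    refine ge_of_tendsto' (lmc.sub ((lac.add lbc).div_const 2)) fun n => ?_
    have hrn := hr.1 (φ n)
    have e : dist ((m ∘ φ) n) ((c ∘ φ) n) / (r ∘ φ) n -
        (dist ((a ∘ φ) n) ((c ∘ φ) n) / (r ∘ φ) n + dist ((b ∘ φ) n) ((c ∘ φ) n) / (r ∘ φ) n) / 2
        = (dist (m (φ n)) (c (φ n)) -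
          (dist (a (φ n)) (c (φ n)) + dist (b (φ n)) (c (φ n))) / 2) / r (φ n) := by
      simp only [Function.comp]; ring
    rw [e, le_div_iff₀ hrn]
    exact (hlt (φ n)).le
  linarith

lemma midQuot_lt_aux (p w x y z : X) (η : ℝ) (hw : w = x ∨ w = y)
    (h : midQuot p w x y z < (η : EReal)) :
    |dist w z - dist x y / 2| ≤ η * max (dist x p) (dist y p) := by
  unfold midQuot at h
  by_cases hxy : x = p ∧ y = p
  · rw [if_pos hxy] at h
    by_cases hz : z = p
    · obtain ⟨hx, hy⟩ := hxy
      have : w = p := by rcases hw with e | e <;> simp [e, hx, hy]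
      simp [hz, hx, hy, this]
    · rw [if_neg hz] at h
      exact absurd h (by simp)
  · rw [if_neg hxy, EReal.coe_lt_coe_iff] at h
    have hpos : 0 < max (dist x p) (dist y p) := by
      by_contra hn
      push Not at hn
      exact hxy ⟨dist_le_zero.1 ((le_max_left _ _).trans hn),
        dist_le_zero.1 ((le_max_right _ _).trans hn)⟩
    exact ((div_lt_iff₀ hpos).1 h).le

lemma tendsto_midQuot_aux (p : X) (w x y z : ℕ → X) (hz : ∀ n, x n = p → y n = p → z n = p)
    (h : ∀ ε > 0, ∀ᶠ n in atTop,
      |dist (w n) (z n) - dist (x n) (y n) / 2| ≤ ε * max (dist (x n) p) (dist (y n) p)) :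
    Tendsto (fun n => midQuot p (w n) (x n) (y n) (z n)) atTop (𝓝 (0 : EReal)) := by
  have e : (fun n => midQuot p (w n) (x n) (y n) (z n)) = fun n =>
      ((|dist (w n) (z n) - dist (x n) (y n) / 2| / max (dist (x n) p) (dist (y n) p) : ℝ)
        : EReal) := by
    funext n
    unfold midQuot
    split_ifs with h1 h2
    · simp [h1.1, h1.2]
    · exact absurd (hz n h1.1 h1.2) h2
    · rfl
  rw [e, ← EReal.coe_zero, EReal.tendsto_coe, Metric.tendsto_nhds]
  intro ε hε
  filter_upwards [h (ε / 2) (by positivity)] with n hn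
  have h0 : 0 ≤ max (dist (x n) p) (dist (y n) p) := le_max_of_le_left dist_nonneg
  rw [Real.dist_eq, sub_zero, abs_of_nonneg (by positivity)]
  have := div_le_of_le_mul₀ h0 (by positivity) hn
  linarith

end Helpers

/-- if every pretangent space is a geodesic metric space which is
Busemann convex, then `X` is Busemann convex at `p`. -/
theorem busemannConvexAt_of_pretangent_busemannConvex
    {X : Type u} [MetricSpace X] (p : X)
    (h : ∀ (r : ℕ → ℝ) (F : Set (ℕ → X)) (Ω : Type u) [MetricSpace Ω]
      (π : (ℕ → X) → Ω), IsPretangentSpace p r F π →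
      IsGeodesicSpace Ω ∧ BusemannConvex Ω) :
    BusemannConvexAt p := by
  constructor
  · intro x y hx hy
    let f : ℕ → X → ℝ := fun n z => max |dist (x n) z - dist (x n) (y n) / 2|
      |dist (y n) z - dist (x n) (y n) / 2|
    let δ : ℕ → ℝ := fun n => max (dist (x n) p) (dist (y n) p)
    have hδ : ∀ n, 0 ≤ δ n := fun n => le_max_of_le_left dist_nonneg
    have hf0 : ∀ n z, 0 ≤ f n z := fun n z => le_max_of_le_left (abs_nonneg _)
    have hex : ∀ n, ∃ z, ∀ w, f n z ≤ f n w + δ n / ((n : ℝ) + 1) := by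
      intro n
      rcases (hδ n).eq_or_lt with h0 | h0
      · have hx0 : x n = p := dist_le_zero.1 ((le_max_left _ _).trans h0.symm.le)
        have hy0 : y n = p := dist_le_zero.1 ((le_max_right _ _).trans h0.symm.le)
        refine ⟨p, fun w => ?_⟩
        have : f n p = 0 := by simp [f, hx0, hy0]
        rw [this, ← h0]
        simpa using hf0 n w
      · have : Nonempty X := ⟨p⟩
        have hbdd : BddBelow (Set.range (f n)) := ⟨0, by rintro _ ⟨z, rfl⟩; exact hf0 n z⟩
        have hpos : 0 < δ n / ((n : ℝ) + 1) := by positivity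
        obtain ⟨z, hz⟩ := exists_lt_of_ciInf_lt (lt_add_of_pos_right (⨅ z, f n z) hpos)
        exact ⟨z, fun w => hz.le.trans (by gcongr; exact ciInf_le hbdd w)⟩
    choose z hz using hex
    have hzp : ∀ n, x n = p → y n = p → z n = p := by
      intro n h1 h2
      have := hz n p
      simp only [f, δ, h1, h2, dist_self, zero_div, sub_zero, max_self, abs_zero, add_zero] at this
      rw [abs_of_nonneg dist_nonneg] at this
      exact (dist_le_zero.1 this).symm
    have hev : ∀ ε > 0, ∀ᶠ n in atTop, f n (z n) ≤ ε * δ n := by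
      intro ε hε
      obtain ⟨η, hη, hloc⟩ := local_midpoint_aux p h (ε / 2) (by positivity)
      filter_upwards [Metric.tendsto_nhds.1 hx η hη, Metric.tendsto_nhds.1 hy η hη,
        normalizing_one_div_aux.eventually_lt_const (half_pos hε)] with n h1 h2 h3
      obtain ⟨w, hw1, hw2⟩ := hloc _ _ h1 h2
      have hfw : f n w ≤ ε / 2 * δ n := max_le hw1 hw2
      have := mul_le_mul_of_nonneg_right h3.le (hδ n)
      have e : δ n / ((n : ℝ) + 1) = 1 / ((n : ℝ) + 1) * δ n := by ring
      have := hz n w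
      linarith
    exact ⟨z, tendsto_midQuot_aux p x x y z hzp
        (fun ε hε => (hev ε hε).mono fun n hn => (le_max_left _ _).trans hn),
      tendsto_midQuot_aux p y x y z hzp
        (fun ε hε => (hev ε hε).mono fun n hn => (le_max_right _ _).trans hn)⟩
  · intro x0 x1 y m h0 h1 hy hm
    rw [Metric.tendsto_nhds]
    intro ε hε
    obtain ⟨η, hη, hloc⟩ := local_busemann_aux p h (ε / 2) (by positivity)
    have hη' : (0 : EReal) < (η : EReal) := by exact_mod_cast hη
    filter_upwards [Metric.tendsto_nhds.1 h0 η hη, Metric.tendsto_nhds.1 h1 η hη,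
      Metric.tendsto_nhds.1 hy η hη, hm.1.eventually_lt_const hη',
      hm.2.eventually_lt_const hη'] with n e0 e1 ey em0 em1
    have hd : 0 ≤ delta3 p (x0 n) (y n) (x1 n) := le_max_of_le_left dist_nonneg
    have key := hloc _ _ _ _ e0 e1 ey (midQuot_lt_aux _ _ _ _ _ _ (Or.inl rfl) em0)
      (midQuot_lt_aux _ _ _ _ _ _ (Or.inr rfl) em1)
    rw [Real.dist_eq, sub_zero, abs_of_nonneg (div_nonneg (le_max_right _ _) hd)]
    have := div_le_of_le_mul₀ hd (by positivity : (0 : ℝ) ≤ ε / 2)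
      (max_le key (by positivity))
    linarith
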